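/- arXiv:2405.16670 — 2 statements merged into one kernel-verified Lean document; each statement's English description precedes it below -/
import Mathlib

section
/- Under the stated hypotheses on ψ₁ and Γ (including Γ(r,±a) = 0), for every μ ∈ (0,1) there is an absolute constant c such that ∫_Ω ( (∂_z³ψ₁)² + (∂_r∂_z²ψ₁)² ) r^{2μ} + 2μ(1−μ) ∫_Ω (∂_z²ψ₁)² r^{2μ−2} ≤ c ∫_Ω (∂_zΓ)² r^{2μ}. -/
open MeasureTheory Real Set ENNReal

noncomputable section

/-- Partial derivative in `r` of a function `w r z` of two variables. -/
def qdr (w : ℝ → ℝ → ℝ) : ℝ → ℝ → ℝ := fun r z => deriv (fun x => w x z) r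

/-- Partial derivative in `z` of a function `w r z` of two variables. -/
def qdz (w : ℝ → ℝ → ℝ) : ℝ → ℝ → ℝ := fun r z => deriv (fun x => w r x) z

/-- The integral `∫_Ω w` over the rectangle `(0,R) × (-a,a)` with respect to the
measure `r dr dz`. -/
def I2 (R a : ℝ) (w : ℝ → ℝ → ℝ) : ℝ :=
  ∫ q in (Ioo (0 : ℝ) R) ×ˢ (Ioo (-a) a), w q.1 q.2 * q.1

/-- The data of the elliptic problem for the modified stream function: smooth functions
`ψ₁` and `Γ` on the rectangle `[0,R] × [-a,a]` satisfying
`−∂_r²ψ₁ − (3/r)∂_rψ₁ − ∂_z²ψ₁ = Γ` in the interior (i.e. `−Δψ₁ − (2/r)∂_rψ₁ = Γ`),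
the boundary conditions `ψ₁(R,·) = 0`, `ψ₁(·,±a) = 0`, and the axis condition
`∂_rψ₁(0,·) = 0`. -/
structure StreamData (R a : ℝ) where
  psi : ℝ → ℝ → ℝ
  Gam : ℝ → ℝ → ℝ
  smooth_psi : ContDiff ℝ (⊤ : ℕ∞) (fun q : ℝ × ℝ => psi q.1 q.2)
  smooth_Gam : ContDiff ℝ (⊤ : ℕ∞) (fun q : ℝ × ℝ => Gam q.1 q.2)
  eqn : ∀ r ∈ Ioo (0 : ℝ) R, ∀ z ∈ Ioo (-a) a,
    -qdr (qdr psi) r z - (3 / r) * qdr psi r z - qdz (qdz psi) r z = Gam r z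
  bc_lat : ∀ z ∈ Icc (-a) a, psi R z = 0
  bc_horiz : ∀ r ∈ Icc (0 : ℝ) R, psi r a = 0 ∧ psi r (-a) = 0
  axis : ∀ z ∈ Icc (-a) a, qdr psi 0 z = 0

/-- uncurried smoothness -/
def Sm (w : ℝ → ℝ → ℝ) : Prop := ContDiff ℝ (⊤ : ℕ∞) (fun q : ℝ × ℝ => w q.1 q.2)

lemma Sm.has_r {w : ℝ → ℝ → ℝ} (h : Sm w) (r z : ℝ) :
    HasDerivAt (fun x => w x z) (fderiv ℝ (fun q : ℝ × ℝ => w q.1 q.2) (r, z) (1, 0)) r := by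
  have h1 : HasFDerivAt (fun q : ℝ × ℝ => w q.1 q.2)
      (fderiv ℝ (fun q : ℝ × ℝ => w q.1 q.2) (r, z)) (r, z) :=
    ((ContDiff.differentiable h (by simp)) (r, z)).hasFDerivAt
  have h2 : HasDerivAt (fun x : ℝ => (x, z)) ((1 : ℝ), (0 : ℝ)) r :=
    (hasDerivAt_id r).prodMk (hasDerivAt_const r z)
  exact HasFDerivAt.comp_hasDerivAt r h1 h2

lemma Sm.has_z {w : ℝ → ℝ → ℝ} (h : Sm w) (r z : ℝ) :
    HasDerivAt (fun x => w r x) (fderiv ℝ (fun q : ℝ × ℝ => w q.1 q.2) (r, z) (0, 1)) z := by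
  have h1 : HasFDerivAt (fun q : ℝ × ℝ => w q.1 q.2)
      (fderiv ℝ (fun q : ℝ × ℝ => w q.1 q.2) (r, z)) (r, z) :=
    ((ContDiff.differentiable h (by simp)) (r, z)).hasFDerivAt
  have h2 : HasDerivAt (fun x : ℝ => (r, x)) ((0 : ℝ), (1 : ℝ)) z :=
    (hasDerivAt_const z r).prodMk (hasDerivAt_id z)
  exact HasFDerivAt.comp_hasDerivAt z h1 h2

lemma Sm.qdr_eq {w : ℝ → ℝ → ℝ} (h : Sm w) (r z : ℝ) :
    qdr w r z = fderiv ℝ (fun q : ℝ × ℝ => w q.1 q.2) (r, z) (1, 0) := (h.has_r r z).deriv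

lemma Sm.qdz_eq {w : ℝ → ℝ → ℝ} (h : Sm w) (r z : ℝ) :
    qdz w r z = fderiv ℝ (fun q : ℝ × ℝ => w q.1 q.2) (r, z) (0, 1) := (h.has_z r z).deriv

lemma Sm.dr {w : ℝ → ℝ → ℝ} (h : Sm w) (r z : ℝ) :
    HasDerivAt (fun x => w x z) (qdr w r z) r := by rw [h.qdr_eq]; exact h.has_r r z

lemma Sm.dz {w : ℝ → ℝ → ℝ} (h : Sm w) (r z : ℝ) :
    HasDerivAt (fun x => w r x) (qdz w r z) z := by rw [h.qdz_eq]; exact h.has_z r z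

lemma Sm.fd {w : ℝ → ℝ → ℝ} (h : Sm w) (v : ℝ × ℝ) :
    ContDiff ℝ (⊤ : ℕ∞) (fun q : ℝ × ℝ => fderiv ℝ (fun q : ℝ × ℝ => w q.1 q.2) q v) := by
  have : ContDiff ℝ (⊤ : ℕ∞) (fderiv ℝ (fun q : ℝ × ℝ => w q.1 q.2)) :=
    ContDiff.fderiv_right h (by simp)
  exact this.clm_apply contDiff_const

lemma Sm.qdr {w : ℝ → ℝ → ℝ} (h : Sm w) : Sm (qdr w) := by
  unfold Sm
  simp only [h.qdr_eq]
  exact h.fd _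

lemma Sm.qdz {w : ℝ → ℝ → ℝ} (h : Sm w) : Sm (qdz w) := by
  unfold Sm
  simp only [h.qdz_eq]
  exact h.fd _

lemma Sm.comm {w : ℝ → ℝ → ℝ} (h : Sm w) : _root_.qdz (_root_.qdr w) = _root_.qdr (_root_.qdz w) := by
  funext r z
  have hd : Differentiable ℝ (fderiv ℝ (fun q : ℝ × ℝ => w q.1 q.2)) :=
    (ContDiff.fderiv_right (m := (⊤ : ℕ∞)) h (by simp)).differentiable (by simp)
  rw [h.qdr.qdz_eq, h.qdz.qdr_eq]
  simp only [h.qdr_eq, h.qdz_eq, Prod.mk.eta]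
  rw [fderiv_clm_apply (hd _) (by fun_prop), fderiv_clm_apply (hd _) (by fun_prop)]
  have hs : IsSymmSndFDerivAt ℝ (fun q : ℝ × ℝ => w q.1 q.2) (r, z) :=
    (ContDiff.contDiffAt h).isSymmSndFDerivAt
      (by simp only [minSmoothness_of_isRCLikeNormedField]; exact WithTop.coe_le_coe.2 (le_top : (2 : ℕ∞) ≤ ⊤))
  simp
  exact hs _ _

lemma Sm.cont {w : ℝ → ℝ → ℝ} (h : Sm w) : Continuous (fun q : ℝ × ℝ => w q.1 q.2) :=
  ContDiff.continuous h

/-- the measure on the rectangle -/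
lemma rect_int (R a : ℝ) (F : ℝ × ℝ → ℝ) (hF : Continuous F) (φ : ℝ → ℝ)
    (hφ : IntegrableOn φ (Ioo 0 R)) :
    IntegrableOn (fun q : ℝ × ℝ => F q * φ q.1) ((Ioo (0 : ℝ) R) ×ˢ (Ioo (-a) a)) := by
  obtain ⟨C, hC⟩ := ((isCompact_Icc (a := (0 : ℝ)) (b := R)).prod
    (isCompact_Icc (a := -a) (b := a))).exists_bound_of_continuousOn hF.continuousOn
  have h1 : IntegrableOn (fun q : ℝ × ℝ => φ q.1) ((Ioo (0 : ℝ) R) ×ˢ (Ioo (-a) a)) := by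
    unfold IntegrableOn
    rw [Measure.volume_eq_prod, ← Measure.prod_restrict]
    exact Integrable.comp_fst hφ _
  refine Integrable.bdd_mul (c := C) h1 hF.aestronglyMeasurable ?_
  filter_upwards [ae_restrict_mem (measurableSet_Ioo.prod measurableSet_Ioo)] with q hq
  exact hC q ⟨Ioo_subset_Icc_self hq.1, Ioo_subset_Icc_self hq.2⟩

lemma rpow_int (R s : ℝ) (hs : -1 < s) (hR : 0 < R) :
    IntegrableOn (fun r : ℝ => r ^ s) (Ioo 0 R) := by
  have := intervalIntegral.intervalIntegrable_rpow' (a := 0) (b := R) hs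
  rw [intervalIntegrable_iff_integrableOn_Ioo_of_le hR.le] at this
  exact this

lemma int_dr_zero (R a : ℝ) (hR : 0 < R) (A A' : ℝ → ℝ → ℝ)
    (hc : ∀ z ∈ Ioo (-a) a, ContinuousOn (fun r => A r z) (Icc 0 R))
    (hd : ∀ r ∈ Ioo 0 R, ∀ z ∈ Ioo (-a) a, HasDerivAt (fun r => A r z) (A' r z) r)
    (h0 : ∀ z ∈ Ioo (-a) a, A 0 z = 0) (h1 : ∀ z ∈ Ioo (-a) a, A R z = 0)
    (hi : IntegrableOn (fun q : ℝ × ℝ => A' q.1 q.2) ((Ioo (0 : ℝ) R) ×ˢ (Ioo (-a) a)))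
    (hi' : ∀ z ∈ Ioo (-a) a, IntegrableOn (fun r => A' r z) (Ioo 0 R)) :
    ∫ q in (Ioo (0 : ℝ) R) ×ˢ (Ioo (-a) a), A' q.1 q.2 = 0 := by
  unfold IntegrableOn at hi
  rw [Measure.volume_eq_prod, ← Measure.prod_restrict] at hi ⊢
  rw [integral_prod_symm _ hi]
  apply integral_eq_zero_of_ae
  filter_upwards [ae_restrict_mem measurableSet_Ioo] with z hz
  have := intervalIntegral.integral_eq_sub_of_hasDerivAt_of_le hR.le (hc z hz)
    (fun r hr => hd r hr z hz)
    ((intervalIntegrable_iff_integrableOn_Ioo_of_le hR.le).2 (hi' z hz))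
  rw [intervalIntegral.integral_of_le hR.le, integral_Ioc_eq_integral_Ioo, h0 z hz, h1 z hz] at this
  simpa using this

lemma int_dz_zero (R a : ℝ) (ha : 0 < a) (A A' : ℝ → ℝ → ℝ)
    (hd : ∀ r ∈ Ioo 0 R, ∀ z, HasDerivAt (fun z => A r z) (A' r z) z)
    (h0 : ∀ r ∈ Ioo 0 R, A r (-a) = 0) (h1 : ∀ r ∈ Ioo 0 R, A r a = 0)
    (hi : IntegrableOn (fun q : ℝ × ℝ => A' q.1 q.2) ((Ioo (0 : ℝ) R) ×ˢ (Ioo (-a) a)))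
    (hi' : ∀ r ∈ Ioo 0 R, Continuous (fun z => A' r z)) :
    ∫ q in (Ioo (0 : ℝ) R) ×ˢ (Ioo (-a) a), A' q.1 q.2 = 0 := by
  unfold IntegrableOn at hi
  rw [Measure.volume_eq_prod, ← Measure.prod_restrict] at hi ⊢
  rw [integral_prod _ hi]
  apply integral_eq_zero_of_ae
  filter_upwards [ae_restrict_mem measurableSet_Ioo] with r hr
  have haa : -a ≤ a := by linarith
  have := intervalIntegral.integral_eq_sub_of_hasDerivAt (a := -a) (b := a)
    (fun z _ => hd r hr z) ((hi' r hr).intervalIntegrable _ _)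
  rw [intervalIntegral.integral_of_le haa, integral_Ioc_eq_integral_Ioo, h0 r hr, h1 r hr] at this
  simpa using this

lemma core (R a μ : ℝ) (hR : 0 < R) (ha : 0 < a) (hμ : μ ∈ Ioo (0 : ℝ) 1)
    (w G : ℝ → ℝ → ℝ) (hw : Sm w) (hG : Sm G)
    (eqn : ∀ r ∈ Ioo (0 : ℝ) R, ∀ z ∈ Ioo (-a) a,
      -qdr (qdr w) r z - (3 / r) * qdr w r z - qdz (qdz w) r z = qdz G r z)
    (hlat : ∀ z ∈ Ioo (-a) a, w R z = 0)
    (hh : ∀ r ∈ Ioo (0 : ℝ) R, w r a = 0 ∧ w r (-a) = 0) :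
    I2 R a (fun r z => ((qdz w r z) ^ 2 + (qdr w r z) ^ 2) * r ^ (2 * μ)) +
            2 * μ * (1 - μ) * I2 R a (fun r z => (w r z) ^ 2 * r ^ (2 * μ - 2)) ≤
          1 * I2 R a (fun r z => (G r z) ^ 2 * r ^ (2 * μ)) := by
  obtain ⟨hμ0, hμ1⟩ := hμ
  have ew : ∀ r : ℝ, 0 < r → r ^ (2 * μ) * r = r ^ (2 * μ + 1) := fun r hr => by
    rw [rpow_add_one hr.ne']
  have ew2 : ∀ r : ℝ, 0 < r → r ^ (2 * μ - 2) * r = r ^ (2 * μ - 1) := fun r hr => by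
    rw [← rpow_add_one hr.ne']; congr 1; ring
  have ew3 : ∀ r : ℝ, 0 < r → r ^ (2 * μ) = r ^ (2 * μ - 2) * r * r := fun r hr => by
    rw [← rpow_add_one hr.ne', ← rpow_add_one hr.ne']; congr 1; ring
  have msR : MeasurableSet ((Ioo (0 : ℝ) R) ×ˢ (Ioo (-a) a)) :=
    measurableSet_Ioo.prod measurableSet_Ioo
  have cw := hw.cont
  have cwr := hw.qdr.cont
  have cwz := hw.qdz.cont
  have cwrr := hw.qdr.qdr.cont
  have cwzz := hw.qdz.qdz.cont
  have cG := hG.cont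
  have cGz := hG.qdz.cont
  have i1 := rpow_int R (2 * μ + 1) (by linarith) hR
  have i2 := rpow_int R (2 * μ - 1) (by linarith) hR
  have i3 := rpow_int R (2 * μ) (by linarith) hR
  -- base integrability
  have I1 : ∀ F : ℝ × ℝ → ℝ, Continuous F →
      IntegrableOn (fun q : ℝ × ℝ => F q * q.1 ^ (2 * μ) * q.1) ((Ioo (0 : ℝ) R) ×ˢ (Ioo (-a) a)) := by
    intro F hF
    refine (rect_int R a F hF _ i1).congr_fun (fun q hq => ?_) msR
    simp only [mul_assoc, ew _ hq.1.1]
  have I2' : ∀ F : ℝ × ℝ → ℝ, Continuous F →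
      IntegrableOn (fun q : ℝ × ℝ => F q * q.1 ^ (2 * μ - 2) * q.1) ((Ioo (0 : ℝ) R) ×ˢ (Ioo (-a) a)) := by
    intro F hF
    refine (rect_int R a F hF _ i2).congr_fun (fun q hq => ?_) msR
    simp only [mul_assoc, ew2 _ hq.1.1]
  have I3 : ∀ F : ℝ × ℝ → ℝ, Continuous F →
      IntegrableOn (fun q : ℝ × ℝ => F q * q.1 ^ (2 * μ)) ((Ioo (0 : ℝ) R) ×ˢ (Ioo (-a) a)) :=
    fun F hF => rect_int R a F hF _ i3
  have ZA : ∫ q in (Ioo (0 : ℝ) R) ×ˢ (Ioo (-a) a),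
      ((qdr w q.1 q.2 ^ 2 + w q.1 q.2 * qdr (qdr w) q.1 q.2) * q.1 ^ (2 * μ + 1)
        + 3 * (w q.1 q.2 * qdr w q.1 q.2) * q.1 ^ (2 * μ)
        + 2 * μ * (1 - μ) * w q.1 q.2 ^ 2 * q.1 ^ (2 * μ - 1)) = 0 := by
    refine int_dr_zero R a hR
      (fun r z => w r z * qdr w r z * r ^ (2 * μ + 1) + (1 - μ) * (w r z ^ 2 * r ^ (2 * μ)))
      (fun r z => (qdr w r z ^ 2 + w r z * qdr (qdr w) r z) * r ^ (2 * μ + 1)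
        + 3 * (w r z * qdr w r z) * r ^ (2 * μ)
        + 2 * μ * (1 - μ) * w r z ^ 2 * r ^ (2 * μ - 1)) ?_ ?_ ?_ ?_ ?_ ?_
    · intro z hz
      apply Continuous.continuousOn
      have e1 : Continuous (fun r : ℝ => r ^ (2 * μ + 1)) :=
        continuous_id.rpow_const (fun _ => Or.inr (by linarith))
      have e2 : Continuous (fun r : ℝ => r ^ (2 * μ)) :=
        continuous_id.rpow_const (fun _ => Or.inr (by linarith))
      have e3 : Continuous (fun r => w r z) := cw.comp (by fun_prop : Continuous fun r : ℝ => (r, z))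
      have e4 : Continuous (fun r => qdr w r z) :=
        cwr.comp (by fun_prop : Continuous fun r : ℝ => (r, z))
      fun_prop
    · intro r hr z hz
      have d1 := hw.dr r z
      have d2 := hw.qdr.dr r z
      have d3 := Real.hasDerivAt_rpow_const (x := r) (p := 2 * μ + 1) (Or.inl hr.1.ne')
      have d4 := Real.hasDerivAt_rpow_const (x := r) (p := 2 * μ) (Or.inl hr.1.ne')
      refine (((d1.mul d2).mul d3).add (((d1.pow 2).mul d4).const_mul (1 - μ))).congr_deriv ?_
      have e : (2 * μ + 1 - 1) = 2 * μ := by ring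
      simp only [e, Pi.mul_apply, Pi.pow_apply]
      ring
    · intro z hz
      simp [zero_rpow (by linarith : 2 * μ + 1 ≠ 0), hμ0.ne']
    · intro z hz
      simp [hlat z hz]
    · exact ((rect_int R a (fun q => qdr w q.1 q.2 ^ 2 + w q.1 q.2 * qdr (qdr w) q.1 q.2)
        (by fun_prop) _ i1).add
        (rect_int R a (fun q => 3 * (w q.1 q.2 * qdr w q.1 q.2)) (by fun_prop) _ i3)).add
        (rect_int R a (fun q => 2 * μ * (1 - μ) * w q.1 q.2 ^ 2) (by fun_prop) _ i2)
    · intro z hz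
      have pz : Continuous fun r : ℝ => (r, z) := by fun_prop
      have key : ∀ (F : ℝ → ℝ) (φ : ℝ → ℝ), Continuous F → IntegrableOn φ (Ioo 0 R) →
          IntegrableOn (fun r => F r * φ r) (Ioo 0 R) := by
        intro F φ hF hφ
        obtain ⟨C, hC⟩ := (isCompact_Icc (a := (0 : ℝ)) (b := R)).exists_bound_of_continuousOn
          hF.continuousOn
        refine Integrable.bdd_mul (c := C) hφ hF.aestronglyMeasurable ?_
        filter_upwards [ae_restrict_mem measurableSet_Ioo] with q hq
        exact hC q (Ioo_subset_Icc_self hq)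
      have e3 : Continuous (fun r => w r z) := cw.comp pz
      have e4 : Continuous (fun r => qdr w r z) := cwr.comp pz
      have e5 : Continuous (fun r => qdr (qdr w) r z) := cwrr.comp pz
      exact ((key (fun r => qdr w r z ^ 2 + w r z * qdr (qdr w) r z) _ (by fun_prop) i1).add
        (key (fun r => 3 * (w r z * qdr w r z)) _ (by fun_prop) i3)).add
        (key (fun r => 2 * μ * (1 - μ) * w r z ^ 2) _ (by fun_prop) i2)
  have ZB : ∫ q in (Ioo (0 : ℝ) R) ×ˢ (Ioo (-a) a),
      (qdz w q.1 q.2 ^ 2 + w q.1 q.2 * qdz (qdz w) q.1 q.2 + qdz w q.1 q.2 * G q.1 q.2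
        + w q.1 q.2 * qdz G q.1 q.2) * q.1 ^ (2 * μ + 1) = 0 := by
    refine int_dz_zero R a ha
      (fun r z => (w r z * qdz w r z + w r z * G r z) * r ^ (2 * μ + 1))
      (fun r z => (qdz w r z ^ 2 + w r z * qdz (qdz w) r z + qdz w r z * G r z
        + w r z * qdz G r z) * r ^ (2 * μ + 1)) ?_ ?_ ?_ ?_ ?_
    · intro r hr z
      have d1 := hw.dz r z
      have d2 := hw.qdz.dz r z
      have d3 := hG.dz r z
      refine (((d1.mul d2).add (d1.mul d3)).mul_const (r ^ (2 * μ + 1))).congr_deriv ?_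
      ring
    · intro r hr
      simp [(hh r hr).2]
    · intro r hr
      simp [(hh r hr).1]
    · exact rect_int R a (fun q => qdz w q.1 q.2 ^ 2 + w q.1 q.2 * qdz (qdz w) q.1 q.2
        + qdz w q.1 q.2 * G q.1 q.2 + w q.1 q.2 * qdz G q.1 q.2) (by fun_prop) _ i1
    · intro r hr
      have pz : Continuous fun z : ℝ => (r, z) := by fun_prop
      have e3 : Continuous (fun z => w r z) := cw.comp pz
      have e4 : Continuous (fun z => qdz w r z) := cwz.comp pz
      have e5 : Continuous (fun z => qdz (qdz w) r z) := cwzz.comp pz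
      have e6 : Continuous (fun z => G r z) := cG.comp pz
      have e7 : Continuous (fun z => qdz G r z) := cGz.comp pz
      fun_prop
  have JA := ((rect_int R a (fun q => qdr w q.1 q.2 ^ 2 + w q.1 q.2 * qdr (qdr w) q.1 q.2)
        (by fun_prop) _ i1).add
        (rect_int R a (fun q => 3 * (w q.1 q.2 * qdr w q.1 q.2)) (by fun_prop) _ i3)).add
        (rect_int R a (fun q => 2 * μ * (1 - μ) * w q.1 q.2 ^ 2) (by fun_prop) _ i2)
  have JB := rect_int R a (fun q => qdz w q.1 q.2 ^ 2 + w q.1 q.2 * qdz (qdz w) q.1 q.2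
        + qdz w q.1 q.2 * G q.1 q.2 + w q.1 q.2 * qdz G q.1 q.2) (by fun_prop) _ i1
  have K1 := I1 (fun q => (qdz w q.1 q.2) ^ 2 + (qdr w q.1 q.2) ^ 2) (by fun_prop)
  have K2 := I2' (fun q => (w q.1 q.2) ^ 2) (by fun_prop)
  have K3 := I1 (fun q => (G q.1 q.2) ^ 2) (by fun_prop)
  have ZAB := integral_add JA JB
  have ZA' := ZA
  simp only [Pi.add_apply] at ZAB
  rw [ZA, ZB] at ZAB
  unfold I2
  rw [one_mul, ← integral_const_mul, ← integral_add K1 (K2.const_mul _)]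
  -- lhs - 2 * (total) ≤ rhs pointwise
  have M := setIntegral_mono_on
    (((K1.add (K2.const_mul (2 * μ * (1 - μ)))).sub ((JA.add JB).const_mul 2))) K3 msR ?_
  · rw [integral_sub' (K1.add (K2.const_mul (2 * μ * (1 - μ)))) ((JA.add JB).const_mul 2),
      integral_const_mul] at M
    simp only [Pi.add_apply] at M
    rw [ZAB] at M
    linarith
  · intro q hq
    obtain ⟨⟨hr0, hrR⟩, hz⟩ := hq
    have E := eqn q.1 ⟨hr0, hrR⟩ q.2 hz
    simp only [Pi.add_apply, Pi.sub_apply]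
    rw [← ew _ hr0, ← ew2 _ hr0, ew3 _ hr0, ← E]
    have hρ : 0 < q.1 ^ (2 * μ - 2) := rpow_pos_of_pos hr0 _
    generalize q.1 ^ (2 * μ - 2) = ρ at *
    generalize q.1 = r at *
    generalize q.2 = z at *
    have e3 : 3 / r * r = 3 := by field_simp
    generalize 3 / r = t at *
    have p1 : 0 ≤ ρ * r * r * r * (qdz w r z + G r z) ^ 2 := by positivity
    have p2 : 0 ≤ ρ * r * r * r * (qdr w r z) ^ 2 := by positivity
    have p3 : 0 ≤ 2 * μ * (1 - μ) * (w r z ^ 2 * ρ * r) := by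
      have : 0 ≤ 1 - μ := by linarith
      positivity
    have e4 : ρ * r * r * (w r z * qdr w r z) * (t * r) = ρ * r * r * (w r z * qdr w r z) * 3 := by
      rw [e3]
    nlinarith [p1, p2, p3, e4]

/-- weighted Sobolev estimate for `ψ₁`: if moreover `Γ(·,±a) = 0`,
then for every `μ ∈ (0,1)`,
`∫_Ω ((∂_z³ψ₁)² + (∂_r∂_z²ψ₁)²) r^{2μ} + 2μ(1−μ) ∫_Ω (∂_z²ψ₁)² r^{2μ−2}
  ≤ c ∫_Ω (∂_zΓ)² r^{2μ}` for an absolute constant `c`. -/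
theorem statement8 :
    ∃ c : ℝ,
      ∀ (R a : ℝ), 0 < R → 0 < a → ∀ S : StreamData R a,
        (∀ r ∈ Set.Icc (0 : ℝ) R, S.Gam r a = 0 ∧ S.Gam r (-a) = 0) →
        ∀ μ ∈ Set.Ioo (0 : ℝ) 1,
          I2 R a (fun r z =>
              ((qdz (qdz (qdz S.psi)) r z) ^ 2 + (qdr (qdz (qdz S.psi)) r z) ^ 2) *
                r ^ (2 * μ)) +
            2 * μ * (1 - μ) *
              I2 R a (fun r z => (qdz (qdz S.psi) r z) ^ 2 * r ^ (2 * μ - 2)) ≤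
          c * I2 R a (fun r z => (qdz S.Gam r z) ^ 2 * r ^ (2 * μ)) := by
  refine ⟨1, fun R a hR ha S hGam μ hμ => ?_⟩
  have hp : Sm S.psi := S.smooth_psi
  have hg : Sm S.Gam := S.smooth_Gam
  refine core R a μ hR ha hμ _ _ hp.qdz.qdz hg.qdz ?_ ?_ ?_
  · intro r hr
    -- differentiate once
    have step : ∀ (u g : ℝ → ℝ → ℝ), Sm u → Sm g →
        (∀ z ∈ Ioo (-a) a, -qdr (qdr u) r z - (3 / r) * qdr u r z - qdz (qdz u) r z = g r z) →
        (∀ z ∈ Ioo (-a) a, -qdr (qdr (qdz u)) r z - (3 / r) * qdr (qdz u) r z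
          - qdz (qdz (qdz u)) r z = qdz g r z) := by
      intro u g hu hg h z hz
      have d1 := ((hu.qdr.qdr.dz r z).neg.sub ((hu.qdr.dz r z).const_mul (3 / r))).sub
        (hu.qdz.qdz.dz r z)
      have d2 := (hg.dz r z).congr_of_eventuallyEq
        (Filter.eventually_of_mem (isOpen_Ioo.mem_nhds hz) h)
      have := d1.unique d2
      rw [hu.qdr.comm, hu.comm] at this
      exact this
    exact step _ _ hp.qdz hg.qdz (step _ _ hp hg (S.eqn r hr))
  · intro z hz
    have h1 : ∀ z ∈ Ioo (-a) a, qdz S.psi R z = 0 := by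
      intro z hz
      have := (hasDerivAt_const z (0 : ℝ)).congr_of_eventuallyEq
        (Filter.eventually_of_mem (isOpen_Ioo.mem_nhds hz)
          (fun y hy => S.bc_lat y (Ioo_subset_Icc_self hy)))
      exact (hp.dz R z).unique this
    have := (hasDerivAt_const z (0 : ℝ)).congr_of_eventuallyEq
        (Filter.eventually_of_mem (isOpen_Ioo.mem_nhds hz) h1)
    exact (hp.qdz.dz R z).unique this
  · intro r hr
    have key : ∀ b ∈ Icc (-a) a, (∀ r ∈ Ioo 0 R, S.psi r b = 0) → S.Gam r b = 0 →
        qdz (qdz S.psi) r b = 0 := by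
      intro b hb h0 hgb
      have h1 : ∀ r ∈ Ioo 0 R, qdr S.psi r b = 0 := by
        intro r hr
        have := (hasDerivAt_const r (0 : ℝ)).congr_of_eventuallyEq
          (Filter.eventually_of_mem (isOpen_Ioo.mem_nhds hr) h0)
        exact (hp.dr r b).unique this
      have h2 : qdr (qdr S.psi) r b = 0 := by
        have := (hasDerivAt_const r (0 : ℝ)).congr_of_eventuallyEq
          (Filter.eventually_of_mem (isOpen_Ioo.mem_nhds hr) h1)
        exact (hp.qdr.dr r b).unique this
      have pz : Continuous fun z : ℝ => (r, z) := by fun_prop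
      have c1 : Continuous (fun z => qdr (qdr S.psi) r z) := hp.qdr.qdr.cont.comp pz
      have c2 : Continuous (fun z => qdr S.psi r z) := hp.qdr.cont.comp pz
      have c3 : Continuous (fun z => qdz (qdz S.psi) r z) := hp.qdz.qdz.cont.comp pz
      have c4 : Continuous (fun z => S.Gam r z) := hg.cont.comp pz
      have hcl : IsClosed {z | -qdr (qdr S.psi) r z - (3 / r) * qdr S.psi r z
          - qdz (qdz S.psi) r z = S.Gam r z} :=
        isClosed_eq (by fun_prop) c4
      have hsub := closure_minimal (fun z hz => S.eqn r hr z hz) hcl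
      rw [closure_Ioo (by linarith)] at hsub
      have this : -qdr (qdr S.psi) r b - (3 / r) * qdr S.psi r b
          - qdz (qdz S.psi) r b = S.Gam r b := hsub hb
      rw [h2, h1 r hr, hgb] at this
      linarith
    have hr' := Ioo_subset_Icc_self hr
    exact ⟨key a ⟨by linarith, le_rfl⟩ (fun r hr => (S.bc_horiz r (Ioo_subset_Icc_self hr)).1)
        (hGam r hr').1,
      key (-a) ⟨le_rfl, by linarith⟩ (fun r hr => (S.bc_horiz r (Ioo_subset_Icc_self hr)).2)
        (hGam r hr').2⟩
end
end

section
/- Under the stated hypotheses on ψ₁ and Γ (including Γ(r,±a) = 0), there is an absolute constant c such that |(1/r) ∂_r∂_zψ₁|_{2,Ω} ≤ c |∂_zΓ|_{2,Ω}. -/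
open MeasureTheory Real Set ENNReal

noncomputable section

/-- Directional derivative. -/
def DD (v : ℝ × ℝ) (F : ℝ × ℝ → ℝ) : ℝ × ℝ → ℝ := fun q => fderiv ℝ F q v

lemma DD_smooth {F : ℝ × ℝ → ℝ} (v : ℝ × ℝ) (hF : ContDiff ℝ (⊤ : ℕ∞) F) :
    ContDiff ℝ (⊤ : ℕ∞) (DD v F) := by
  unfold DD
  have h : ContDiff ℝ (⊤ : ℕ∞) (fderiv ℝ F) := hF.fderiv_right (by simp)
  exact h.clm_apply contDiff_const

lemma smooth_diff {F : ℝ × ℝ → ℝ} (hF : ContDiff ℝ (⊤ : ℕ∞) F) : Differentiable ℝ F :=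
  hF.differentiable (by simp)

lemma DD_comm {F : ℝ × ℝ → ℝ} (u v : ℝ × ℝ) (hF : ContDiff ℝ (⊤ : ℕ∞) F) :
    DD u (DD v F) = DD v (DD u F) := by
  have h : ContDiff ℝ (⊤ : ℕ∞) (fderiv ℝ F) := hF.fderiv_right (by simp)
  have hd : Differentiable ℝ (fderiv ℝ F) := h.differentiable (by simp)
  funext q
  have key : ∀ x y : ℝ × ℝ, DD x (DD y F) q = fderiv ℝ (fderiv ℝ F) q x y := by
    intro x y
    have h1 := (hd q).hasFDerivAt.clm_apply (hasFDerivAt_const y q)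
    have h2 : fderiv ℝ (DD y F) q = _ := h1.fderiv
    show fderiv ℝ (DD y F) q x = _
    rw [h2]; simp
  rw [key, key]
  have hs : IsSymmSndFDerivAt ℝ F q :=
    (hF.contDiffAt (x := q)).isSymmSndFDerivAt (by
      rw [minSmoothness_of_isRCLikeNormedField]
      exact WithTop.coe_le_coe.2 (le_top : (2 : ℕ∞) ≤ ⊤))
  exact hs u v

lemma hasDeriv_r {F : ℝ × ℝ → ℝ} (hF : ContDiff ℝ (⊤ : ℕ∞) F) (r z : ℝ) :
    HasDerivAt (fun x => F (x, z)) (DD (1, 0) F (r, z)) r := by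
  have h := (smooth_diff hF (r, z)).hasFDerivAt
  have h2 : HasDerivAt (fun x : ℝ => (x, z)) ((1 : ℝ), (0 : ℝ)) r :=
    (hasDerivAt_id r).prodMk (hasDerivAt_const r z)
  exact h.comp_hasDerivAt r h2

lemma hasDeriv_z {F : ℝ × ℝ → ℝ} (hF : ContDiff ℝ (⊤ : ℕ∞) F) (r z : ℝ) :
    HasDerivAt (fun x => F (r, x)) (DD (0, 1) F (r, z)) z := by
  have h := (smooth_diff hF (r, z)).hasFDerivAt
  have h2 : HasDerivAt (fun x : ℝ => (r, x)) ((0 : ℝ), (1 : ℝ)) z :=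
    (hasDerivAt_const z r).prodMk (hasDerivAt_id z)
  exact h.comp_hasDerivAt z h2

lemma qdr_eq {w : ℝ → ℝ → ℝ} {F : ℝ × ℝ → ℝ} (hF : ContDiff ℝ (⊤ : ℕ∞) F)
    (hw : ∀ r z, w r z = F (r, z)) (r z : ℝ) : qdr w r z = DD (1, 0) F (r, z) := by
  unfold qdr
  simp only [hw]
  exact (hasDeriv_r hF r z).deriv

lemma qdz_eq {w : ℝ → ℝ → ℝ} {F : ℝ × ℝ → ℝ} (hF : ContDiff ℝ (⊤ : ℕ∞) F)
    (hw : ∀ r z, w r z = F (r, z)) (r z : ℝ) : qdz w r z = DD (0, 1) F (r, z) := by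
  unfold qdz
  simp only [hw]
  exact (hasDeriv_z hF r z).deriv

lemma zero_Icc {h : ℝ → ℝ} (hc : Continuous h) {a b : ℝ} (hab : a < b)
    (h0 : ∀ x ∈ Ioo a b, h x = 0) : ∀ x ∈ Icc a b, h x = 0 := by
  intro x hx
  rw [← closure_Ioo hab.ne] at hx
  have : EqOn h (fun _ => 0) (closure (Ioo a b)) :=
    EqOn.closure (fun x hx => h0 x hx) hc continuous_const
  exact this hx

lemma DDr_zero {F : ℝ × ℝ → ℝ} (hF : ContDiff ℝ (⊤ : ℕ∞) F) {a b z : ℝ} (hab : a < b)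
    (h0 : ∀ x ∈ Icc a b, F (x, z) = 0) : ∀ x ∈ Icc a b, DD (1, 0) F (x, z) = 0 := by
  refine zero_Icc ?_ hab ?_
  · exact (DD_smooth _ hF).continuous.comp (by fun_prop)
  · intro x hx
    rw [← (hasDeriv_r hF x z).deriv]
    have : (fun x => F (x, z)) =ᶠ[nhds x] fun _ => 0 := by
      filter_upwards [Ioo_mem_nhds hx.1 hx.2] with y hy
      exact h0 y (Ioo_subset_Icc_self hy)
    rw [this.deriv_eq]; simp

lemma DDz_zero {F : ℝ × ℝ → ℝ} (hF : ContDiff ℝ (⊤ : ℕ∞) F) {a b r : ℝ} (hab : a < b)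
    (h0 : ∀ x ∈ Icc a b, F (r, x) = 0) : ∀ x ∈ Icc a b, DD (0, 1) F (r, x) = 0 := by
  refine zero_Icc ?_ hab ?_
  · exact (DD_smooth _ hF).continuous.comp (by fun_prop)
  · intro x hx
    rw [← (hasDeriv_z hF r x).deriv]
    have : (fun x => F (r, x)) =ᶠ[nhds x] fun _ => 0 := by
      filter_upwards [Ioo_mem_nhds hx.1 hx.2] with y hy
      exact h0 y (Ioo_subset_Icc_self hy)
    rw [this.deriv_eq]; simp

/-- Core estimate. -/
lemma core_s12 (R a : ℝ) (hR : 0 < R) (ha : 0 < a) (P G : ℝ × ℝ → ℝ)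
    (hP : ContDiff ℝ (⊤ : ℕ∞) P) (hG : ContDiff ℝ (⊤ : ℕ∞) G)
    (eqn : ∀ r ∈ Ioo (0 : ℝ) R, ∀ z ∈ Ioo (-a) a,
      -DD (1, 0) (DD (1, 0) P) (r, z) - (3 / r) * DD (1, 0) P (r, z)
        - DD (0, 1) (DD (0, 1) P) (r, z) = G (r, z))
    (bl : ∀ z ∈ Icc (-a) a, P (R, z) = 0)
    (bh : ∀ r ∈ Icc (0 : ℝ) R, P (r, a) = 0 ∧ P (r, -a) = 0)
    (ax : ∀ z ∈ Icc (-a) a, DD (1, 0) P (0, z) = 0)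
    (hg : ∀ r ∈ Icc (0 : ℝ) R, G (r, a) = 0 ∧ G (r, -a) = 0) :
    ∫ q in (Ioo (0 : ℝ) R) ×ˢ (Ioo (-a) a),
        ((1 / q.1) * DD (1, 0) (DD (0, 1) P) q) ^ 2 * q.1 ≤
      ∫ q in (Ioo (0 : ℝ) R) ×ˢ (Ioo (-a) a), (DD (0, 1) G q) ^ 2 * q.1 := by
  have haa : -a < a := by linarith
  have hP1 := DD_smooth (1, 0) hP
  have hP2 := DD_smooth (0, 1) hP
  have hP11 := DD_smooth (1, 0) hP1
  have hP22 := DD_smooth (0, 1) hP2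
  set φ := DD (0, 1) P with hφ
  have hφr := DD_smooth (1, 0) hP2
  have hφrr := DD_smooth (1, 0) hφr
  have hφzz := DD_smooth (0, 1) hP22
  have hφrz := DD_smooth (0, 1) hφr
  have hGz := DD_smooth (0, 1) hG
  have c1 : DD (0, 1) (DD (1, 0) P) = DD (1, 0) φ := DD_comm _ _ hP
  have c2 : DD (0, 1) (DD (1, 0) (DD (1, 0) P)) = DD (1, 0) (DD (1, 0) φ) := by
    rw [DD_comm _ _ hP1, c1]
  have c3 : DD (1, 0) (DD (0, 1) φ) = DD (0, 1) (DD (1, 0) φ) := DD_comm _ _ hP2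
  -- differentiated equation
  have eqz : ∀ r ∈ Ioo (0 : ℝ) R, ∀ z ∈ Ioo (-a) a,
      -DD (1, 0) (DD (1, 0) φ) (r, z) - (3 / r) * DD (1, 0) φ (r, z)
        - DD (0, 1) (DD (0, 1) φ) (r, z) = DD (0, 1) G (r, z) := by
    intro r hr z hz
    have d := (((hasDeriv_z hP11 r z).neg).sub
      ((hasDeriv_z hP1 r z).const_mul (3 / r))).sub (hasDeriv_z hP22 r z)
    rw [c2, c1] at d
    have e := hasDeriv_z hG r z
    refine d.unique (e.congr_of_eventuallyEq ?_)
    filter_upwards [Ioo_mem_nhds hz.1 hz.2] with y hy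
    exact eqn r hr y hy
  -- boundary
  have bφR : ∀ z ∈ Icc (-a) a, DD (0, 1) φ (R, z) = 0 :=
    DDz_zero hP2 haa (DDz_zero hP haa bl)
  have bφ0 : ∀ z ∈ Icc (-a) a, DD (1, 0) φ (0, z) = 0 := by
    rw [← c1]; exact DDz_zero hP1 haa ax
  have eqcl : ∀ r ∈ Ioo (0 : ℝ) R, ∀ z ∈ Icc (-a) a,
      -DD (1, 0) (DD (1, 0) P) (r, z) - (3 / r) * DD (1, 0) P (r, z)
        - DD (0, 1) φ (r, z) - G (r, z) = 0 := by
    intro r hr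
    refine zero_Icc ?_ haa ?_
    · have := hP11.continuous
      have := hP1.continuous
      have := hP22.continuous
      have := hG.continuous
      fun_prop
    · intro z hz; linarith [eqn r hr z hz]
  have bz : ∀ z ∈ Icc (-a) a, (∀ r ∈ Icc (0 : ℝ) R, P (r, z) = 0) →
      (∀ r ∈ Icc (0 : ℝ) R, G (r, z) = 0) → ∀ r ∈ Icc (0 : ℝ) R, DD (0, 1) φ (r, z) = 0 := by
    intro z hz hPz hGz
    refine zero_Icc (hP22.continuous.comp (by fun_prop)) hR ?_
    intro r hr
    have e := eqcl r hr z hz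
    have hr' := Ioo_subset_Icc_self hr
    have z1 := DDr_zero hP hR hPz
    rw [hGz r hr', z1 r hr', DDr_zero hP1 hR z1 r hr'] at e
    show DD (0, 1) φ (r, z) = 0
    linarith
  have ba := bz a ⟨haa.le, le_rfl⟩ (fun r hr => (bh r hr).1) (fun r hr => (hg r hr).1)
  have bma := bz (-a) ⟨le_rfl, haa.le⟩ (fun r hr => (bh r hr).2) (fun r hr => (hg r hr).2)
  -- divergence theorem
  set φr := DD (1, 0) φ with hφrdef
  set φz := DD (0, 1) φ with hφzdef
  let f : ℝ × ℝ → ℝ := fun q => φr q ^ 2 / 2 - φz q ^ 2 / 2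
  let g : ℝ × ℝ → ℝ := fun q => φz q * φr q
  have hf : ContDiff ℝ (⊤ : ℕ∞) f := ((hφr.pow 2).div_const 2).sub ((hP22.pow 2).div_const 2)
  have hgs : ContDiff ℝ (⊤ : ℕ∞) g := hP22.mul hφr
  have hdiv : ∀ q, DD (1, 0) f q + DD (0, 1) g q =
      DD (1, 0) φr q * φr q + DD (0, 1) φz q * φr q := by
    rintro ⟨r, z⟩
    have d1 := (((hasDeriv_r hφr r z).pow 2).div_const 2).sub
      (((hasDeriv_r hP22 r z).pow 2).div_const 2)
    have d2 := (hasDeriv_z hP22 r z).mul (hasDeriv_z hφr r z)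
    rw [(hasDeriv_r hf r z).unique d1, (hasDeriv_z hgs r z).unique d2]
    rw [c3]
    simp
    ring
  have hcf := (DD_smooth (1, 0) hf).continuous
  have hcg := (DD_smooth (0, 1) hgs).continuous
  have hcomp : IsCompact (Icc ((0 : ℝ), -a) (R, a)) := isCompact_Icc
  have hsub : (Ioo (0 : ℝ) R) ×ˢ (Ioo (-a) a) ⊆ Icc ((0 : ℝ), -a) (R, a) := by
    rw [← Icc_prod_Icc]
    exact prod_mono Ioo_subset_Icc_self Ioo_subset_Icc_self
  have hint : ∀ h : ℝ × ℝ → ℝ, Continuous h →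
      IntegrableOn h ((Ioo (0 : ℝ) R) ×ˢ (Ioo (-a) a)) := fun h hh =>
    (hh.continuousOn.integrableOn_compact hcomp).mono_set hsub
  have hD := integral_divergence_prod_Icc_of_hasFDerivAt_of_le f g (fderiv ℝ f) (fderiv ℝ g)
    ((0 : ℝ), -a) (R, a) ⟨hR.le, haa.le⟩ hf.continuous.continuousOn hgs.continuous.continuousOn
    (fun x _ => (smooth_diff hf x).hasFDerivAt) (fun x _ => (smooth_diff hgs x).hasFDerivAt)
    ((hcf.add hcg).continuousOn.integrableOn_compact hcomp)
  have hae : ∫ q in Icc ((0 : ℝ), -a) (R, a), (fderiv ℝ f q (1, 0) + fderiv ℝ g q (0, 1)) =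
      ∫ q in (Ioo (0 : ℝ) R) ×ˢ (Ioo (-a) a), (DD (1, 0) f q + DD (0, 1) g q) := by
    rw [← Icc_prod_Icc]
    refine setIntegral_congr_set ?_
    exact (Measure.set_prod_ae_eq Ioo_ae_eq_Icc Ioo_ae_eq_Icc).symm
  have hpos : 0 ≤ ∫ q in (Ioo (0 : ℝ) R) ×ˢ (Ioo (-a) a), (DD (1, 0) f q + DD (0, 1) g q) := by
    rw [← hae, hD]
    have t1 : ∫ x in (0 : ℝ)..R, g (x, a) = 0 := by
      rw [intervalIntegral.integral_congr (g := fun _ => (0 : ℝ))]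
      · simp
      · intro x hx
        rw [uIcc_of_le hR.le] at hx
        simp [g, ba x hx]
    have t2 : ∫ x in (0 : ℝ)..R, g (x, -a) = 0 := by
      rw [intervalIntegral.integral_congr (g := fun _ => (0 : ℝ))]
      · simp
      · intro x hx
        rw [uIcc_of_le hR.le] at hx
        simp [g, bma x hx]
    have t3 : 0 ≤ ∫ y in (-a)..a, f (R, y) := by
      refine intervalIntegral.integral_nonneg haa.le ?_
      intro y hy
      simp only [f, bφR y hy]
      nlinarith [sq_nonneg (φr (R, y))]
    have t4 : 0 ≤ ∫ y in (-a)..a, -f (0, y) := by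
      refine intervalIntegral.integral_nonneg haa.le ?_
      intro y hy
      simp only [f, bφ0 y hy]
      nlinarith [sq_nonneg (φz (0, y))]
    rw [intervalIntegral.integral_neg] at t4
    simp only [t1, t2]
    linarith
  have hms : MeasurableSet ((Ioo (0 : ℝ) R) ×ˢ (Ioo (-a) a)) :=
    measurableSet_Ioo.prod measurableSet_Ioo
  have hGc : Continuous fun q : ℝ × ℝ => (DD (0, 1) G q) ^ 2 * q.1 :=
    (hGz.continuous.pow 2).mul continuous_fst
  calc _ ≤ ∫ q in (Ioo (0 : ℝ) R) ×ˢ (Ioo (-a) a), ((DD (0, 1) G q) ^ 2 * q.1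
            - (DD (1, 0) f q + DD (0, 1) g q)) := by
        refine integral_mono_of_nonneg ?_ (hint _ (hGc.sub (hcf.add hcg))) ?_
        · refine (ae_restrict_iff' hms).2 (Filter.Eventually.of_forall fun q hq => ?_)
          exact mul_nonneg (sq_nonneg _) hq.1.1.le
        · refine (ae_restrict_iff' hms).2 (Filter.Eventually.of_forall fun q hq => ?_)
          obtain ⟨r, z⟩ := q
          have hr : 0 < r := hq.1.1
          have e := eqz r hq.1 z hq.2
          show ((1 / r) * φr (r, z)) ^ 2 * r ≤ (DD (0, 1) G (r, z)) ^ 2 * r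
            - (DD (1, 0) f (r, z) + DD (0, 1) g (r, z))
          rw [hdiv]
          generalize DD (0, 1) G (r, z) = γ at *
          generalize DD (1, 0) φr (r, z) = A at *
          generalize DD (0, 1) φz (r, z) = B at *
          generalize φr (r, z) = u at *
          obtain ⟨v, rfl⟩ : ∃ v, u = r * v := ⟨u / r, by field_simp⟩
          have e1 : 1 / r * (r * v) = v := by field_simp
          have e2 : 3 / r * (r * v) = 3 * v := by field_simp
          rw [e1]
          rw [e2] at e
          have hA : A = -B - 3 * v - γ := by linarith
          rw [hA]
          nlinarith [mul_nonneg hr.le (sq_nonneg (2 * γ + v)), mul_nonneg hr.le (sq_nonneg v)]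
    _ = (∫ q in (Ioo (0 : ℝ) R) ×ˢ (Ioo (-a) a), (DD (0, 1) G q) ^ 2 * q.1)
          - ∫ q in (Ioo (0 : ℝ) R) ×ˢ (Ioo (-a) a), (DD (1, 0) f q + DD (0, 1) g q) :=
        integral_sub (hint _ hGc) (hint _ (hcf.add hcg))
    _ ≤ _ := by linarith

/-- weighted `H³` estimate for `ψ₁`: if moreover `Γ(·,±a) = 0`, then
`|(1/r) ∂_r∂_zψ₁|_{2,Ω} ≤ c |∂_zΓ|_{2,Ω}` for an absolute constant `c`. -/
theorem statement12 :
    ∃ c : ℝ,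
      ∀ (R a : ℝ), 0 < R → 0 < a → ∀ S : StreamData R a,
        (∀ r ∈ Set.Icc (0 : ℝ) R, S.Gam r a = 0 ∧ S.Gam r (-a) = 0) →
        Real.sqrt (I2 R a (fun r z => ((1 / r) * qdr (qdz S.psi) r z) ^ 2)) ≤
          c * Real.sqrt (I2 R a (fun r z => (qdz S.Gam r z) ^ 2)) := by
  refine ⟨1, fun R a hR ha S hg => ?_⟩
  rw [one_mul]
  refine Real.sqrt_le_sqrt ?_
  have hP := S.smooth_psi
  have hG := S.smooth_Gam
  have e1 := qdr_eq hP (w := S.psi) (fun _ _ => rfl)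
  have e2 := qdz_eq hP (w := S.psi) (fun _ _ => rfl)
  have e11 := qdr_eq (DD_smooth (1, 0) hP) e1
  have e22 := qdz_eq (DD_smooth (0, 1) hP) e2
  have e12 := qdr_eq (DD_smooth (0, 1) hP) e2
  have eG := qdz_eq hG (w := S.Gam) (fun _ _ => rfl)
  unfold I2
  simp only [e12, eG]
  refine core_s12 R a hR ha _ _ hP hG ?_ S.bc_lat S.bc_horiz ?_ hg
  · intro r hr z hz
    rw [← e11, ← e1, ← e22]
    exact S.eqn r hr z hz
  · intro z hz
    rw [← e1]
    exact S.axis z hz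
end
end
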